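/- arXiv:1010.6300 — 3 statements merged into one kernel-verified Lean document; each statement's English description precedes it below -/
import Mathlib

section
/- Let ν ∈ {−1/2, 1/2} and set I_ν := ∫_0^∞ (1/p)·Q_ν((1/2)(p + 1/p)) dp. Then I_ν is finite and there exists a constant C ∈ ℝ (one may take C = −2I_ν) such that for all real numbers a, b with 1 < a < b, ∫_a^b ∫_a^b (1/p)(1/p')·Q_ν((1/2)(p/p' + p'/p)) dp' dp ≥ I_ν · log(b/a) + C. -/
open MeasureTheory Real

/-- Legendre function of the second kind:
`Q_ν(t) = ∫_0^{t−√(t²−1)} x^ν/√(x²−2tx+1) dx`. -/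
noncomputable def legendreQ (ν t : ℝ) : ℝ :=
  ∫ x in (0:ℝ)..(t - Real.sqrt (t ^ 2 - 1)), x ^ ν / Real.sqrt (x ^ 2 - 2 * t * x + 1)

open Set

theorem integrableOn_rpow_mul_one_sub_rpow {a b : ℝ} (ha : -1 < a) (hb : -1 < b) :
    IntegrableOn (fun x : ℝ => x ^ a * (1 - x) ^ b) (Ioo 0 1) := by
  have h := Complex.betaIntegral_convergent (u := ((a + 1 : ℝ) : ℂ)) (v := ((b + 1 : ℝ) : ℂ))
    (by rw [Complex.ofReal_re]; linarith) (by rw [Complex.ofReal_re]; linarith)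
  rw [intervalIntegrable_iff_integrableOn_Ioo_of_le zero_le_one] at h
  refine IntegrableOn.congr_fun h.norm (fun x hx => ?_) measurableSet_Ioo
  have h1 : (0 : ℝ) < 1 - x := by linarith [hx.2]
  have h2 : (1 : ℂ) - (x : ℂ) = ((1 - x : ℝ) : ℂ) := by push_cast; rfl
  simp only [norm_mul]
  rw [h2, Complex.norm_cpow_eq_rpow_re_of_pos hx.1, Complex.norm_cpow_eq_rpow_re_of_pos h1]
  simp

theorem legendreQ_nonneg {ν t : ℝ} (ht : 0 ≤ t) : 0 ≤ legendreQ ν t := by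
  have h0 : 0 ≤ t - √(t ^ 2 - 1) := by
    rw [sub_nonneg, Real.sqrt_le_iff]
    exact ⟨ht, by linarith⟩
  exact intervalIntegral.integral_nonneg h0 fun x hx =>
    div_nonneg (rpow_nonneg hx.1 _) (Real.sqrt_nonneg _)

theorem measurable_legendreQ (ν : ℝ) : Measurable (legendreQ ν) := by
  have h : legendreQ ν = fun t => (t - √(t ^ 2 - 1)) * ∫ y in Ioc (0 : ℝ) 1,
      ((t - √(t ^ 2 - 1)) * y) ^ ν /
        √(((t - √(t ^ 2 - 1)) * y) ^ 2 - 2 * t * ((t - √(t ^ 2 - 1)) * y) + 1) := by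
    funext t
    have := intervalIntegral.smul_integral_comp_mul_left (a := 0) (b := 1)
      (fun x : ℝ => x ^ ν / √(x ^ 2 - 2 * t * x + 1)) (t - √(t ^ 2 - 1))
    rw [mul_zero, mul_one, smul_eq_mul, intervalIntegral.integral_of_le zero_le_one] at this
    exact this.symm
  rw [h]
  refine Measurable.mul (by fun_prop) (StronglyMeasurable.measurable ?_)
  refine MeasureTheory.StronglyMeasurable.integral_prod_right (Measurable.stronglyMeasurable ?_)
  unfold Function.uncurry
  fun_prop

theorem legendreQ_le {ν s : ℝ} (hν : -1 < ν) (hs0 : 0 < s) (hs1 : s < 1) :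
    legendreQ ν ((1/2) * (s + 1 / s)) ≤
      s ^ (ν + 1) * (1 - s) ^ (-(1/4) : ℝ) *
        ∫ y in Ioo (0 : ℝ) 1, y ^ ν * (1 - y) ^ (-(3/4) : ℝ) := by
  have hlim : (1/2) * (s + 1 / s) - √(((1/2) * (s + 1 / s)) ^ 2 - 1) = s := by
    have h1 : ((1/2) * (s + 1 / s)) ^ 2 - 1 = ((1/2) * (1 / s - s)) ^ 2 := by
      field_simp; ring
    have h2 : s ≤ 1 / s := by
      rw [le_div_iff₀ hs0]; nlinarith
    rw [h1, Real.sqrt_sq (by linarith)]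
    ring
  have hscale := intervalIntegral.smul_integral_comp_mul_left (a := 0) (b := 1)
    (fun x : ℝ => x ^ ν / √(x ^ 2 - 2 * ((1/2) * (s + 1 / s)) * x + 1)) s
  rw [mul_zero, mul_one, smul_eq_mul, intervalIntegral.integral_of_le zero_le_one,
    integral_Ioc_eq_integral_Ioo] at hscale
  rw [legendreQ, hlim, ← hscale, ← integral_const_mul, ← integral_const_mul]
  refine integral_mono_of_nonneg ?_
    ((integrableOn_rpow_mul_one_sub_rpow hν (by norm_num)).const_mul _) ?_
  · refine ae_restrict_of_forall_mem measurableSet_Ioo fun y hy => ?_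
    exact mul_nonneg hs0.le
      (div_nonneg (rpow_nonneg (mul_pos hs0 hy.1).le _) (Real.sqrt_nonneg _))
  · refine ae_restrict_of_forall_mem measurableSet_Ioo fun y hy => ?_
    obtain ⟨hy0, hy1⟩ := hy
    have hA : 0 < 1 - y := by linarith
    have hS : 0 < 1 - s := by linarith
    have hquad : (s * y) ^ 2 - 2 * ((1/2) * (s + 1 / s)) * (s * y) + 1
        = (1 - y) * (1 - s ^ 2 * y) := by
      field_simp; ring
    have hBA : 1 - y ≤ 1 - s ^ 2 * y := by nlinarith [mul_pos hy0 hS, mul_pos hs0 hS]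
    have hBS : 1 - s ≤ 1 - s ^ 2 * y := by
      nlinarith [mul_pos hs0 hA, mul_pos hs0 hy0, mul_pos (mul_pos hs0 hy0) hS]
    have hB : 0 < 1 - s ^ 2 * y := hA.trans_le hBA
    have hlow : (1 - y) ^ (3/4 : ℝ) * (1 - s) ^ (1/4 : ℝ)
        ≤ √((1 - y) * (1 - s ^ 2 * y)) := by
      rw [Real.sqrt_eq_rpow, mul_rpow hA.le hB.le, show (3/4 : ℝ) = 1/2 + 1/4 by norm_num,
        rpow_add hA, mul_assoc]
      refine mul_le_mul_of_nonneg_left ?_ (rpow_nonneg hA.le _)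
      calc (1 - y) ^ (1/4 : ℝ) * (1 - s) ^ (1/4 : ℝ)
          ≤ (1 - s ^ 2 * y) ^ (1/4 : ℝ) * (1 - s ^ 2 * y) ^ (1/4 : ℝ) := by gcongr
        _ = (1 - s ^ 2 * y) ^ (1/2 : ℝ) := by
          rw [← rpow_add hB]; norm_num
    simp only
    rw [hquad]
    calc s * ((s * y) ^ ν / √((1 - y) * (1 - s ^ 2 * y)))
        ≤ s * ((s * y) ^ ν / ((1 - y) ^ (3/4 : ℝ) * (1 - s) ^ (1/4 : ℝ))) := by gcongr
      _ = s ^ (ν + 1) * (1 - s) ^ (-(1/4) : ℝ) * (y ^ ν * (1 - y) ^ (-(3/4) : ℝ)) := by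
        rw [mul_rpow hs0.le hy0.le, rpow_add_one hs0.ne', rpow_neg hS.le, rpow_neg hA.le]
        field_simp

/-- The kernel `r ↦ Q_ν((r + 1/r)/2) / r`, whose integral over `(0, ∞)` is the constant `I_ν`. -/
noncomputable def scaleKernel (ν r : ℝ) : ℝ :=
  (1 / r) * legendreQ ν ((1/2) * (r + 1 / r))

theorem measurable_scaleKernel (ν : ℝ) : Measurable (scaleKernel ν) := by
  have h := measurable_legendreQ ν
  unfold scaleKernel
  exact (by fun_prop : Measurable fun r : ℝ => 1 / r).mul (h.comp (by fun_prop))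

theorem scaleKernel_nonneg {ν r : ℝ} (hr : 0 < r) : 0 ≤ scaleKernel ν r :=
  mul_nonneg (by positivity) (legendreQ_nonneg (by positivity))

theorem scaleKernel_inv (ν : ℝ) {r : ℝ} (hr : 0 < r) :
    scaleKernel ν r⁻¹ = r ^ 2 * scaleKernel ν r := by
  have h : r⁻¹ + 1 / r⁻¹ = r + 1 / r := by field_simp; ring
  rw [scaleKernel, scaleKernel, h]
  field_simp

theorem one_le_rpow_neg_add_rpow {c r : ℝ} (hc : 0 ≤ c) (hr : 0 < r) :
    1 ≤ r ^ (-c) + r ^ c := by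
  rcases le_total r 1 with h | h
  · linarith [one_le_rpow_of_pos_of_le_one_of_nonpos hr h (neg_nonpos.mpr hc),
      rpow_nonneg hr.le c]
  · linarith [one_le_rpow h hc, rpow_nonneg hr.le (-c)]

theorem integrableOn_weight_mul_scaleKernel {ν c : ℝ} (hc : 0 ≤ c) (hν : c - 1 < ν) :
    IntegrableOn (fun r => (r ^ (-c) + r ^ c) * scaleKernel ν r) (Ioi 0) := by
  set h : ℝ → ℝ := fun r => (r ^ (-c) + r ^ c) * scaleKernel ν r
  have hmeas : Measurable h := by
    have := measurable_scaleKernel ν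
    fun_prop
  set B : ℝ := ∫ y in Ioo (0 : ℝ) 1, y ^ ν * (1 - y) ^ (-(3/4) : ℝ)
  have h01 : IntegrableOn h (Ioo 0 1) := by
    refine Integrable.mono'
      ((integrableOn_rpow_mul_one_sub_rpow (a := ν - c) (b := -(1/4))
        (by linarith) (by norm_num)).const_mul (2 * B))
      hmeas.aestronglyMeasurable
      (ae_restrict_of_forall_mem measurableSet_Ioo fun r hr => ?_)
    obtain ⟨hr0, hr1⟩ := hr
    have hk := scaleKernel_nonneg (ν := ν) hr0
    have hw : r ^ c ≤ r ^ (-c) := rpow_le_rpow_of_exponent_ge hr0 hr1.le (by linarith)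
    have hw0 : 0 < r ^ (-c) := rpow_pos_of_pos hr0 _
    rw [Real.norm_of_nonneg (mul_nonneg (by positivity) hk)]
    calc (r ^ (-c) + r ^ c) * scaleKernel ν r
        ≤ (2 * r ^ (-c)) * scaleKernel ν r := by gcongr; linarith
      _ ≤ (2 * r ^ (-c)) * ((1 / r) * (r ^ (ν + 1) * (1 - r) ^ (-(1/4) : ℝ) * B)) := by
        unfold scaleKernel
        gcongr
        exact legendreQ_le (by linarith) hr0 hr1
      _ = 2 * B * (r ^ (ν - c) * (1 - r) ^ (-(1/4) : ℝ)) := by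
        rw [rpow_add_one hr0.ne', sub_eq_add_neg ν c, rpow_add hr0]
        field_simp
  have hind : IntegrableOn ((Ioo 0 1).indicator h) (Ioi 0) :=
    ((integrable_indicator_iff measurableSet_Ioo).mpr h01).integrableOn
  have hinv := (integrableOn_Ioi_comp_rpow_iff' _ (p := -1) (by norm_num)).mpr hind
  have h1 : IntegrableOn h (Ioi 1) := by
    refine (hinv.mono_set (Ioi_subset_Ioi zero_le_one)).congr_fun (fun r hr => ?_)
      measurableSet_Ioi
    have hr1 : (1 : ℝ) < r := hr
    have hr0 : 0 < r := one_pos.trans hr1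
    simp only [rpow_neg_one]
    have hmem : r⁻¹ ∈ Ioo (0 : ℝ) 1 := ⟨inv_pos.mpr hr0, inv_lt_one_of_one_lt₀ hr1⟩
    rw [indicator_of_mem hmem]
    simp only [h]
    rw [scaleKernel_inv ν hr0, inv_rpow hr0.le, inv_rpow hr0.le, rpow_neg hr0.le c, inv_inv,
      smul_eq_mul, show (-1 - 1 : ℝ) = -(2 : ℕ) by norm_num, rpow_neg hr0.le, rpow_natCast]
    field_simp
    ring
  have hIoc : IntegrableOn h (Ioc 0 1) :=
    h01.congr_set_ae Ioo_ae_eq_Ioc.symm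
  rw [← Ioc_union_Ioi_eq_Ioi zero_le_one]
  exact hIoc.union h1

theorem integrableOn_scaleKernel {ν : ℝ} (hν : -1 < ν) :
    IntegrableOn (scaleKernel ν) (Ioi 0) := by
  refine Integrable.mono' (integrableOn_weight_mul_scaleKernel (c := 0) le_rfl (by linarith))
    (measurable_scaleKernel ν).aestronglyMeasurable
    (ae_restrict_of_forall_mem measurableSet_Ioi fun r hr => ?_)
  rw [Real.norm_of_nonneg (scaleKernel_nonneg hr)]
  simpa using le_mul_of_one_le_left (scaleKernel_nonneg (ν := ν) hr)
    (one_le_rpow_neg_add_rpow (c := 0) le_rfl hr)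

/-- Truncating the integral of `scaleKernel ν` to `(α, β)` costs at most a power of `α` and of
`1/β`. -/
theorem integral_scaleKernel_ge {ν c α β : ℝ} (hc : 0 ≤ c) (hν : c - 1 < ν) (hα : 0 < α)
    (hαβ : α ≤ β) :
    (∫ r in Ioi (0 : ℝ), scaleKernel ν r) -
        (α ^ c + β ^ (-c)) * ∫ r in Ioi (0 : ℝ), (r ^ (-c) + r ^ c) * scaleKernel ν r ≤
      ∫ r in α..β, scaleKernel ν r := by
  have hI := integrableOn_scaleKernel (ν := ν) (by linarith)
  have hW := integrableOn_weight_mul_scaleKernel hc hν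
  have hβ : 0 < β := hα.trans_le hαβ
  have hsub : Ioc α β ⊆ Ioi 0 := fun r hr => hα.trans hr.1
  rw [intervalIntegral.integral_of_le hαβ, ← integral_const_mul, ← integral_sub hI (hW.const_mul _),
    ← inter_eq_self_of_subset_right hsub, ← setIntegral_indicator measurableSet_Ioc]
  refine setIntegral_mono_on (hI.sub (hW.const_mul _)) (hI.indicator measurableSet_Ioc)
    measurableSet_Ioi fun r hr => ?_
  have hr0 : (0 : ℝ) < r := hr
  have hk := scaleKernel_nonneg (ν := ν) hr0
  have p1 := rpow_pos_of_pos hα c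
  have p2 := rpow_pos_of_pos hβ (-c)
  have p3 := rpow_pos_of_pos hr0 c
  have p4 := rpow_pos_of_pos hr0 (-c)
  by_cases hmem : r ∈ Ioc α β
  · rw [indicator_of_mem hmem]
    have : 0 ≤ (α ^ c + β ^ (-c)) * ((r ^ (-c) + r ^ c) * scaleKernel ν r) := by positivity
    linarith
  · rw [indicator_of_notMem hmem, sub_nonpos, ← mul_assoc]
    refine le_mul_of_one_le_left hk ?_
    have hcases : r ≤ α ∨ β < r := by
      by_contra! h
      exact hmem ⟨h.1, h.2⟩
    rcases hcases with h | h
    · have h1 : 1 ≤ α ^ c * r ^ (-c) := by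
        rw [rpow_neg hr0.le, ← div_eq_mul_inv, one_le_div p3]
        exact rpow_le_rpow hr0.le h hc
      nlinarith [mul_pos p1 p3, mul_pos p2 p3, mul_pos p2 p4]
    · have h1 : 1 ≤ β ^ (-c) * r ^ c := by
        rw [rpow_neg hβ.le, mul_comm, ← div_eq_mul_inv, one_le_div (rpow_pos_of_pos hβ c)]
        exact rpow_le_rpow hβ.le h.le hc
      nlinarith [mul_pos p1 p3, mul_pos p1 p4, mul_pos p2 p4]

theorem integral_legendreQ_div_eq {ν a b p : ℝ} (hp : 0 < p) (ha : 0 < a) (hb : 0 < b) :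
    (∫ p' in a..b, (1 / p) * (1 / p') * legendreQ ν ((1/2) * (p / p' + p' / p))) =
      (1 / p) * ∫ r in (a / p)..(b / p), scaleKernel ν r := by
  have h := intervalIntegral.integral_comp_div (a := a) (b := b) (scaleKernel ν) hp.ne'
  have : (∫ p' in a..b, (1 / p) * (1 / p') * legendreQ ν ((1/2) * (p / p' + p' / p))) =
      ∫ p' in a..b, (1 / p) ^ 2 * scaleKernel ν (p' / p) := by
    refine intervalIntegral.integral_congr fun q hq => ?_
    have hq0 : 0 < q := (lt_min ha hb).trans_le hq.1
    simp only [scaleKernel]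
    rw [one_div_div, add_comm (q / p)]
    field_simp
  rw [this, intervalIntegral.integral_const_mul, h, smul_eq_mul]
  field_simp

theorem continuousOn_integral_scaleKernel {ν a b : ℝ} (hν : -1 < ν) (ha : 0 < a) (hb : 0 < b) :
    ContinuousOn (fun p => ∫ r in (a / p)..(b / p), scaleKernel ν r) (Ioi 0) := by
  have hI : Integrable ((Ioi 0).indicator (scaleKernel ν)) :=
    (integrable_indicator_iff measurableSet_Ioi).mpr (integrableOn_scaleKernel hν)
  have hcont := intervalIntegral.continuous_primitive
    (fun x y => hI.intervalIntegrable (a := x) (b := y)) 0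
  have hdiv : ∀ d : ℝ, ContinuousOn (fun p : ℝ => d / p) (Ioi 0) := fun d =>
    continuousOn_const.div continuousOn_id fun p hp => ne_of_gt hp
  refine ((hcont.comp_continuousOn (hdiv b)).sub (hcont.comp_continuousOn (hdiv a))).congr
    fun p hp => ?_
  have hp0 : (0 : ℝ) < p := hp
  simp only [Pi.sub_apply, Function.comp_apply]
  rw [intervalIntegral.integral_interval_sub_left hI.intervalIntegrable hI.intervalIntegrable]
  refine intervalIntegral.integral_congr fun r hr => ?_
  have hr0 : 0 < r := (lt_min (div_pos ha hp0) (div_pos hb hp0)).trans_le hr.1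
  exact (indicator_of_mem (mem_Ioi.mpr hr0) _).symm

theorem double_integral_log_lower_bound (ν : ℝ) (hν : ν = -(1/2) ∨ ν = 1/2) :
    IntegrableOn (fun p : ℝ => (1 / p) * legendreQ ν ((1/2) * (p + 1 / p))) (Set.Ioi 0) ∧
    ∃ C : ℝ, ∀ a b : ℝ, 1 < a → a < b →
      (∫ p in a..b, ∫ p' in a..b,
          (1 / p) * (1 / p') * legendreQ ν ((1/2) * (p / p' + p' / p))) ≥
        (∫ p in Set.Ioi (0:ℝ), (1 / p) * legendreQ ν ((1/2) * (p + 1 / p))) *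
            Real.log (b / a) + C := by
  have hν' : (1/4 : ℝ) - 1 < ν := by rcases hν with rfl | rfl <;> norm_num
  have hν1 : -1 < ν := by linarith
  refine ⟨integrableOn_scaleKernel hν1, ?_⟩
  change ∃ C : ℝ, ∀ a b : ℝ, 1 < a → a < b →
      (∫ p in a..b, ∫ p' in a..b,
          (1 / p) * (1 / p') * legendreQ ν ((1/2) * (p / p' + p' / p))) ≥
        (∫ p in Set.Ioi (0:ℝ), scaleKernel ν p) * Real.log (b / a) + C
  set I : ℝ := ∫ p in Set.Ioi (0:ℝ), scaleKernel ν p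
  set K : ℝ := ∫ r in Ioi (0 : ℝ), (r ^ (-(1/4) : ℝ) + r ^ (1/4 : ℝ)) * scaleKernel ν r
  have hK : 0 ≤ K := setIntegral_nonneg measurableSet_Ioi fun r hr => by
    have hr0 : (0 : ℝ) < r := hr
    have := scaleKernel_nonneg (ν := ν) hr0
    positivity
  refine ⟨-(8 * K), fun a b ha1 hab => ?_⟩
  have ha : 0 < a := one_pos.trans ha1
  have hb : 0 < b := ha.trans hab
  have hpos : ∀ p ∈ uIcc a b, 0 < p := fun p hp => by
    rw [uIcc_of_le hab.le] at hp
    exact ha.trans_le hp.1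
  have hsub : uIcc a b ⊆ Ioi 0 := hpos
  rw [intervalIntegral.integral_congr fun p hp => integral_legendreQ_div_eq (ν := ν) (hpos p hp) ha hb]
  have hint : IntervalIntegrable
      (fun p => (1 / p) * ∫ r in (a / p)..(b / p), scaleKernel ν r) volume a b :=
    ((continuousOn_const.div continuousOn_id fun p hp => (hpos p hp).ne').mul
      ((continuousOn_integral_scaleKernel hν1 ha hb).mono hsub)).intervalIntegrable
  -- a primitive of the pointwise lower bound for the outer integrand
  set F : ℝ → ℝ := fun p =>
    I * Real.log p + 4 * K * (a ^ (1/4 : ℝ) * p ^ (-(1/4) : ℝ)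
      - b ^ (-(1/4) : ℝ) * p ^ (1/4 : ℝ)) with hF
  set f : ℝ → ℝ := fun p => I * p⁻¹ + 4 * K * (a ^ (1/4 : ℝ) * (-(1/4) * p ^ (-(1/4) - 1 : ℝ))
      - b ^ (-(1/4) : ℝ) * ((1/4) * p ^ (1/4 - 1 : ℝ)))
  have hderiv : ∀ p ∈ uIcc a b, HasDerivAt F (f p) p := fun p hp => by
    have hp0 := (hpos p hp).ne'
    exact ((Real.hasDerivAt_log hp0).const_mul I).add
      ((((Real.hasDerivAt_rpow_const (p := -(1/4)) (Or.inl hp0)).const_mul _).sub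
        ((Real.hasDerivAt_rpow_const (p := 1/4) (Or.inl hp0)).const_mul _)).const_mul _)
  have hfint : IntervalIntegrable f volume a b := by
    refine ContinuousOn.intervalIntegrable fun p hp => ContinuousAt.continuousWithinAt ?_
    have hp0 := (hpos p hp).ne'
    have c1 := Real.continuousAt_rpow_const p (-(1/4) - 1) (Or.inl hp0)
    have c2 := Real.continuousAt_rpow_const p (1/4 - 1) (Or.inl hp0)
    have c3 := continuousAt_inv₀ hp0
    fun_prop
  have hmono : ∫ p in a..b, f p ≤
      ∫ p in a..b, (1 / p) * ∫ r in (a / p)..(b / p), scaleKernel ν r := by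
    refine intervalIntegral.integral_mono_on hab.le hfint hint fun p hp => ?_
    have hp0 : 0 < p := ha.trans_le hp.1
    have h := integral_scaleKernel_ge (c := 1/4) (by norm_num) hν' (div_pos ha hp0)
      (div_le_div_of_nonneg_right hab.le hp0.le)
    refine le_trans (le_of_eq ?_) (mul_le_mul_of_nonneg_left h (by positivity))
    simp only [f]
    rw [div_rpow ha.le hp0.le, div_rpow hb.le hp0.le, rpow_sub_one hp0.ne', rpow_sub_one hp0.ne',
      rpow_neg hp0.le]
    field_simp
    ring
  rw [intervalIntegral.integral_eq_sub_of_hasDerivAt hderiv hfint] at hmono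
  refine ge_iff_le.mpr (le_trans ?_ hmono)
  have e1 : a ^ (1/4 : ℝ) * a ^ (-(1/4) : ℝ) = 1 := by rw [← rpow_add ha]; norm_num
  have e2 : b ^ (-(1/4) : ℝ) * b ^ (1/4 : ℝ) = 1 := by rw [← rpow_add hb]; norm_num
  simp only [hF]
  rw [e1, e2, Real.log_div hb.ne' ha.ne']
  have q1 : 0 ≤ K * (a ^ (1/4 : ℝ) * b ^ (-(1/4) : ℝ)) := by positivity
  have q2 : 0 ≤ K * (b ^ (-(1/4) : ℝ) * a ^ (1/4 : ℝ)) := by positivity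
  linarith
end

section
/- For every ν > −1 and every p with 0 < p < 1, one has Q_{ν+1}((1/2)(p + 1/p)) ≤ p · Q_ν((1/2)(p + 1/p)). -/
open MeasureTheory Real

lemma half_add_inv_sub_sqrt {p : ℝ} (hp0 : 0 < p) (hp1 : p < 1) :
    (1/2) * (p + 1 / p) - √(((1/2) * (p + 1 / p)) ^ 2 - 1) = p := by
  have h1 : 1 < 1 / p := by rw [lt_div_iff₀ hp0]; linarith
  have h : ((1/2) * (p + 1 / p)) ^ 2 - 1 = ((1/2) * (1 / p - p)) ^ 2 := by
    field_simp
    ring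
  rw [h, Real.sqrt_sq (by linarith)]
  ring

lemma sq_sub_add_one_eq_mul {p : ℝ} (hp0 : 0 < p) (x : ℝ) :
    x ^ 2 - 2 * ((1/2) * (p + 1 / p)) * x + 1 = (p - x) * (1 / p - x) := by
  field_simp
  ring

lemma intervalIntegrable_rpow_div_sqrt_mul {ν p q : ℝ} (hν : -1 < ν) (hp : 0 < p) (hpq : p < q) :
    IntervalIntegrable (fun x : ℝ => x ^ ν / √((p - x) * (q - x))) volume 0 p := by
  have left : IntervalIntegrable (fun x : ℝ => x ^ ν / √((p - x) * (q - x))) volume 0 (p / 2) := by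
    simp only [div_eq_mul_inv (_ ^ ν)]
    refine (intervalIntegral.intervalIntegrable_rpow' hν).mul_continuousOn ?_
    refine ContinuousOn.inv₀ (by fun_prop) fun x hx => ?_
    rw [Set.uIcc_of_le (by linarith)] at hx
    have : 0 < (p - x) * (q - x) := mul_pos (by linarith [hx.2]) (by linarith [hx.2])
    positivity
  have right : IntervalIntegrable (fun x : ℝ => x ^ ν / √((p - x) * (q - x))) volume (p / 2) p := by
    have h : IntervalIntegrable (fun x : ℝ => (p - x) ^ (-(1 / 2) : ℝ)) volume (p / 2) p := by
      have h0 : IntervalIntegrable (fun x : ℝ => x ^ (-(1 / 2) : ℝ)) volume (p / 2) 0 :=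
        intervalIntegral.intervalIntegrable_rpow' (by norm_num)
      have h1 := h0.comp_sub_left p
      rwa [sub_zero, sub_half] at h1
    have hc : ContinuousOn (fun x : ℝ => x ^ ν / √(q - x)) (Set.uIcc (p / 2) p) := by
      rw [Set.uIcc_of_le (by linarith)]
      refine ContinuousOn.div (continuousOn_id.rpow_const fun x hx => Or.inl ?_) (by fun_prop)
        fun x hx => ?_
      · have := hx.1
        simp only [id]
        linarith
      · have : 0 < q - x := by linarith [hx.2]
        positivity
    refine (h.mul_continuousOn hc).congr fun x hx => ?_
    rw [Set.uIoc_of_le (by linarith)] at hx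
    have hx' : 0 ≤ p - x := by linarith [hx.2]
    rw [Real.rpow_neg hx', ← Real.sqrt_eq_rpow, Real.sqrt_mul hx', div_eq_mul_inv, div_eq_mul_inv,
      mul_inv]
    ring
  exact left.trans right

theorem legendreQ_succ_le (ν : ℝ) (hν : -1 < ν) (p : ℝ) (hp0 : 0 < p) (hp1 : p < 1) :
    legendreQ (ν + 1) ((1/2) * (p + 1 / p)) ≤ p * legendreQ ν ((1/2) * (p + 1 / p)) := by
  have hq : p < 1 / p := hp1.trans (by rw [lt_div_iff₀ hp0]; linarith)
  simp only [legendreQ, half_add_inv_sub_sqrt hp0 hp1, sq_sub_add_one_eq_mul hp0]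
  rw [← intervalIntegral.integral_const_mul]
  refine intervalIntegral.integral_mono_on_of_le_Ioo hp0.le
    (intervalIntegrable_rpow_div_sqrt_mul (by linarith) hp0 hq)
    ((intervalIntegrable_rpow_div_sqrt_mul hν hp0 hq).const_mul p) fun x hx => ?_
  rw [Real.rpow_add_one hx.1.ne', mul_comm, mul_div_assoc]
  have := Real.rpow_nonneg hx.1.le ν
  exact mul_le_mul_of_nonneg_right hx.2.le (by positivity)
end

section
/- For every ν > −1 and every real α with α ≥ −ν − 1, the function p ↦ p^α · Q_ν((1/2)(p + 1/p)) is monotone increasing on the interval (0,1). -/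
open MeasureTheory Real

theorem intervalIntegrable_rpow_div_sqrt {ν c : ℝ} (hν : -1 < ν) (hc : c < 1) :
    IntervalIntegrable (fun y : ℝ => y ^ ν / (√(1 - y) * √(1 - c * y))) volume 0 1 := by
  have hb := (Complex.betaIntegral_convergent (u := ((ν + 1 : ℝ) : ℂ)) (v := ((1 / 2 : ℝ) : ℂ))
    (by rw [Complex.ofReal_re]; linarith) (by rw [Complex.ofReal_re]; norm_num)).norm
  obtain ⟨m, hm, hcm⟩ : ∃ m : ℝ, 0 < m ∧ ∀ y ∈ Set.Ioo (0 : ℝ) 1, m ≤ 1 - c * y := by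
    refine ⟨min 1 (1 - c), lt_min one_pos (by linarith), fun y hy => ?_⟩
    rcases le_total c 0 with h | h
    · exact (min_le_left _ _).trans (by nlinarith [hy.1])
    · exact (min_le_right _ _).trans (by nlinarith [hy.2])
  have hb' := hb.const_mul (√m)⁻¹
  rw [intervalIntegrable_iff_integrableOn_Ioo_of_le zero_le_one] at hb' ⊢
  refine Integrable.mono' hb' (Measurable.aestronglyMeasurable (by measurability)) ?_
  filter_upwards [ae_restrict_mem measurableSet_Ioo] with y hy
  have h1 : 0 < 1 - y := sub_pos.2 hy.2
  have hy0 : 0 < y := hy.1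
  have e1 : ‖(y : ℂ) ^ (((ν + 1 : ℝ) : ℂ) - 1)‖ = y ^ ν := by
    rw [Complex.norm_cpow_eq_rpow_re_of_pos hy0]; simp
  have e2 : ‖(1 - (y : ℂ)) ^ (((1 / 2 : ℝ) : ℂ) - 1)‖ = (√(1 - y))⁻¹ := by
    rw [← Complex.ofReal_one, ← Complex.ofReal_sub, ← Complex.ofReal_sub,
      Complex.norm_cpow_eq_rpow_re_of_pos h1, Complex.ofReal_re, sqrt_eq_rpow, ← rpow_neg h1.le]
    norm_num
  rw [norm_mul, e1, e2, Real.norm_of_nonneg (by positivity), div_eq_mul_inv, mul_inv,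
    ← mul_assoc, mul_comm]
  gcongr
  exact hcm y hy

theorem legendreQ_half_add_inv (ν : ℝ) {p : ℝ} (hp : p ∈ Set.Ioo (0 : ℝ) 1) :
    legendreQ ν ((1/2) * (p + 1 / p)) =
      p ^ (ν + 1) * ∫ y in (0 : ℝ)..1, y ^ ν / (√(1 - y) * √(1 - p ^ 2 * y)) := by
  obtain ⟨h0, h1⟩ := hp
  have hsqrt : √(((1/2) * (p + 1 / p)) ^ 2 - 1) = (1/2) * (1 / p - p) := by
    have h : ((1/2) * (p + 1 / p)) ^ 2 - 1 = ((1/2) * (1 / p - p)) ^ 2 := by field_simp; ring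
    rw [h, sqrt_sq]
    have : 1 < 1 / p := (one_lt_div h0).2 h1
    linarith
  have hend : (1/2) * (p + 1 / p) - (1/2) * (1 / p - p) = p := by ring
  have hsub := intervalIntegral.mul_integral_comp_mul_left (a := 0) (b := 1) (c := p)
    (f := fun x => x ^ ν / √(x ^ 2 - 2 * ((1/2) * (p + 1 / p)) * x + 1))
  rw [mul_zero, mul_one] at hsub
  rw [legendreQ, hsqrt, hend, ← hsub, rpow_add_one h0.ne', mul_comm (p ^ ν), mul_assoc,
    ← intervalIntegral.integral_const_mul (p ^ ν)]
  congr 1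
  refine intervalIntegral.integral_congr fun y hy => ?_
  rw [Set.uIcc_of_le zero_le_one] at hy
  have hq : (p * y) ^ 2 - 2 * ((1/2) * (p + 1 / p)) * (p * y) + 1 = (1 - y) * (1 - p ^ 2 * y) := by
    field_simp; ring
  simp only [hq]
  rw [mul_rpow h0.le hy.1, sqrt_mul (sub_nonneg.2 hy.2), mul_div_assoc]

theorem legendreQ_rpow_monotoneOn (ν α : ℝ) (hν : -1 < ν) (hα : -ν - 1 ≤ α) :
    MonotoneOn (fun p : ℝ => p ^ α * legendreQ ν ((1/2) * (p + 1 / p)))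
      (Set.Ioo (0:ℝ) 1) := by
  intro p hp q hq hpq
  have hq1 : q ^ 2 < 1 := pow_lt_one₀ hq.1.le hq.2 two_ne_zero
  have hpq2 : p ^ 2 ≤ q ^ 2 := pow_le_pow_left₀ hp.1.le hpq 2
  simp only [legendreQ_half_add_inv ν hp, legendreQ_half_add_inv ν hq, ← mul_assoc,
    ← rpow_add hp.1, ← rpow_add hq.1]
  refine mul_le_mul (rpow_le_rpow hp.1.le hpq (by linarith)) ?_ ?_ (rpow_nonneg hq.1.le _)
  · refine intervalIntegral.integral_mono_on_of_le_Ioo zero_le_one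
      (intervalIntegrable_rpow_div_sqrt hν (hpq2.trans_lt hq1))
      (intervalIntegrable_rpow_div_sqrt hν hq1) fun y hy => ?_
    have hy0 : 0 < y := hy.1
    have h1 : 0 < 1 - y := sub_pos.2 hy.2
    have h2 : 0 < 1 - q ^ 2 * y := by nlinarith [hy.2]
    gcongr
  · refine intervalIntegral.integral_nonneg zero_le_one fun y hy => ?_
    have := rpow_nonneg hy.1 ν
    positivity
end
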